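/- Let k be a field and λ ∈ k with λ ≠ 0 and λ ≠ 1. Set z = x − y², z' = x − λy², F = x·z·z' in k[x,y]. Let Q_c(2) be the 6×6 matrix over k[x,y] with rows (z, 0, 0, 0, 0, 0), (0, xz, 0, 0, 0, 0), (0, 0, xz, 0, 0, 0), (0, 0, −xy, xz', 0, 0), (0, −xy, 0, 0, xz', 0), (−xy, 0, 0, 0, 0, xz'). Then there exists a 6×6 matrix B over k[x,y] such that Q_c(2)·B = B·Q_c(2) = F·I₆; that is, (Q_c(2), B) is a matrix factorization of F. -/

import Mathlib

open MvPolynomial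

noncomputable section

namespace T36

variable {k : Type} [Field k]

/-- `x = X 0` in `k[x,y]`. -/
def x : MvPolynomial (Fin 2) k := X 0
/-- `y = X 1` in `k[x,y]`. -/
def y : MvPolynomial (Fin 2) k := X 1
/-- `z = x - y²`. -/
def z : MvPolynomial (Fin 2) k := x - y ^ 2
/-- `z' = x - λ y²`. -/
def z' (lam : k) : MvPolynomial (Fin 2) k := x - C lam * y ^ 2
/-- `F = x z z'`. -/
def F (lam : k) : MvPolynomial (Fin 2) k := x * z * z' lam

/-- The matrix `Q_c(2)`. -/
def Qc2 (lam : k) : Matrix (Fin 6) (Fin 6) (MvPolynomial (Fin 2) k) :=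
  !![z, 0, 0, 0, 0, 0;
     0, x * z, 0, 0, 0, 0;
     0, 0, x * z, 0, 0, 0;
     0, 0, -(x * y), x * z' lam, 0, 0;
     0, -(x * y), 0, 0, x * z' lam, 0;
     -(x * y), 0, 0, 0, 0, x * z' lam]

end T36

theorem T36_Qc2_matrix_factorization (k : Type) [Field k] (lam : k)
    (h0 : lam ≠ 0) (h1 : lam ≠ 1) :
    ∃ B : Matrix (Fin 6) (Fin 6) (MvPolynomial (Fin 2) k),
      T36.Qc2 lam * B = T36.F lam • (1 : Matrix (Fin 6) (Fin 6) (MvPolynomial (Fin 2) k)) ∧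
      B * T36.Qc2 lam = T36.F lam • (1 : Matrix (Fin 6) (Fin 6) (MvPolynomial (Fin 2) k)) := by
  refine ⟨!![T36.x * T36.z' lam, 0, 0, 0, 0, 0;
     0, T36.z' lam, 0, 0, 0, 0;
     0, 0, T36.z' lam, 0, 0, 0;
     0, 0, T36.y, T36.z, 0, 0;
     0, T36.y, 0, 0, T36.z, 0;
     T36.x * T36.y, 0, 0, 0, 0, T36.z], ?_, ?_⟩ <;>
  · ext1 i j
    fin_cases i <;> fin_cases j <;>
      simp [T36.Qc2, T36.F, Matrix.mul_apply, Fin.sum_univ_succ, Matrix.one_apply] <;> ring
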